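/- Let T be an invertible n×n complex matrix with Im T := (T - Tᴴ)/(2i) positive semidefinite, and define log T := -i ∫₀^∞ ((T + it·I)⁻¹ - (1 + it)⁻¹·I) dt. Then exp(-2i·Im(tr(log T))) = det(Tᴴ)/det(T), where Im(z) denotes the imaginary part of a complex number z. -/

import Mathlib

open Matrix MeasureTheory
open scoped ComplexOrder

attribute [local instance] Matrix.normedAddCommGroup Matrix.normedSpace

/-- The matrix logarithm `log T := -i ∫₀^∞ ((T + it·I)⁻¹ - (1+it)⁻¹·I) dt` of a
matrix with positive semidefinite imaginary part. -/
noncomputable def matLog {n : ℕ} (T : Matrix (Fin n) (Fin n) ℂ) : Matrix (Fin n) (Fin n) ℂ :=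
  (-Complex.I) •
    ∫ t in Set.Ioi (0 : ℝ),
      ((T + (Complex.I * (t : ℂ)) • (1 : Matrix (Fin n) (Fin n) ℂ))⁻¹
        - (1 + Complex.I * (t : ℂ))⁻¹ • (1 : Matrix (Fin n) (Fin n) ℂ))

open Filter Topology Set

theorem Complex.one_add_I_mul_ofReal_ne_zero (t : ℝ) : 1 + Complex.I * (t : ℂ) ≠ 0 := fun h ↦ by
  simpa using congrArg Complex.re h

namespace Matrix

variable {n : Type*} [DecidableEq n]

theorem one_add_smul_one (z : ℂ) : (1 : Matrix n n ℂ) + z • 1 = (1 + z) • 1 := by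
  rw [add_smul, one_smul]

theorem add_smul_one_eq_smul (T : Matrix n n ℂ) {z : ℂ} (hz : 1 + z ≠ 0) :
    T + z • (1 : Matrix n n ℂ) = (1 + z) • (1 + (1 + z)⁻¹ • (T - 1)) := by
  rw [smul_add, smul_smul, mul_inv_cancel₀ hz, ← one_add_smul_one, one_smul]
  abel

theorem tendsto_one_add_inv_smul (B : Matrix n n ℂ) :
    Tendsto (fun t : ℝ ↦ 1 + (1 + Complex.I * (t : ℂ))⁻¹ • B) atTop (𝓝 1) := by
  have hinv : Tendsto (fun t : ℝ ↦ (1 + Complex.I * (t : ℂ))⁻¹) atTop (𝓝 0) := by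
    refine tendsto_inv₀_cobounded.comp (tendsto_norm_atTop_iff_cobounded.mp ?_)
    refine tendsto_atTop_mono (fun t ↦ ?_) tendsto_id
    have := Complex.abs_im_le_norm (1 + Complex.I * (t : ℂ))
    exact (le_abs_self t).trans (by simpa using this)
  simpa using (hinv.smul_const B).const_add 1

variable [Fintype n]

/-- **Jacobi's formula** at an invertible matrix, along the direction `B`. -/
theorem hasDerivAt_det_add_smul {A : Matrix n n ℂ} (hA : IsUnit A.det) (B : Matrix n n ℂ) :
    HasDerivAt (fun z : ℂ ↦ (A + z • B).det) (A.det * (A⁻¹ * B).trace) 0 := by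
  have hfac : (fun z : ℂ ↦ (A + z • B).det) = fun z ↦ A.det *
      (1 + (A⁻¹ * B).trace * z + (det (1 + (Polynomial.X : Polynomial ℂ) •
        (A⁻¹ * B).map Polynomial.C)).divX.divX.eval z * z ^ 2) := by
    funext z
    rw [← det_one_add_smul, ← det_mul, mul_add, mul_one, mul_smul_comm,
      mul_nonsing_inv_cancel_left _ _ hA]
  rw [hfac]
  refine HasDerivAt.const_mul _ ?_
  have h := (((hasDerivAt_id (0 : ℂ)).const_mul (A⁻¹ * B).trace).const_add 1).add
    ((Polynomial.hasDerivAt (det (1 + (Polynomial.X : Polynomial ℂ) •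
        (A⁻¹ * B).map Polynomial.C)).divX.divX 0).mul ((hasDerivAt_id (0 : ℂ)).pow 2))
  convert! h using 1
  simp

/-- Shifting along the positive imaginary axis preserves invertibility when the imaginary part is
positive semidefinite. -/
theorem isUnit_det_add_I_mul_smul_one {T : Matrix n n ℂ} (hTinv : IsUnit T)
    (hT : ((2 * Complex.I)⁻¹ • (T - Tᴴ)).PosSemidef) {t : ℝ} (ht : 0 ≤ t) :
    IsUnit (T + (Complex.I * (t : ℂ)) • (1 : Matrix n n ℂ)).det := by
  rcases ht.eq_or_lt with rfl | ht
  · simpa using (isUnit_iff_isUnit_det T).mp hTinv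
  rw [isUnit_iff_ne_zero]
  intro h0
  obtain ⟨v, hv, hMv⟩ := exists_mulVec_eq_zero_iff.mpr h0
  have hTv : T *ᵥ v = (-(Complex.I * t)) • v := by
    rw [add_mulVec, smul_mulVec, one_mulVec] at hMv
    rw [neg_smul]
    exact eq_neg_of_add_eq_zero_left hMv
  have hTHv : star v ⬝ᵥ (Tᴴ *ᵥ v) = (Complex.I * t) * (star v ⬝ᵥ v) := by
    rw [dotProduct_mulVec, ← star_mulVec, hTv, star_smul, smul_dotProduct]
    simp
  have hpos : 0 < star v ⬝ᵥ v := dotProduct_star_self_pos_iff.mpr hv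
  have hnonneg := hT.dotProduct_mulVec_nonneg v
  have hval : star v ⬝ᵥ (((2 * Complex.I)⁻¹ • (T - Tᴴ)) *ᵥ v) = -((t : ℂ) * (star v ⬝ᵥ v)) := by
    rw [smul_mulVec, sub_mulVec, dotProduct_smul, dotProduct_sub, hTHv, hTv, dotProduct_smul]
    simp only [smul_eq_mul]
    field_simp [Complex.I_ne_zero]
    ring
  rw [hval] at hnonneg
  have ht' : (0 : ℂ) < t := by exact_mod_cast ht
  exact absurd (mul_pos ht' hpos) (not_lt_of_ge (neg_nonneg.mp hnonneg))

theorem hasDerivAt_det_add_I_mul_smul_one {T : Matrix n n ℂ} {t : ℝ}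
    (h : IsUnit (T + (Complex.I * (t : ℂ)) • (1 : Matrix n n ℂ)).det) :
    HasDerivAt (fun s : ℝ ↦ (T + (Complex.I * (s : ℂ)) • (1 : Matrix n n ℂ)).det)
      ((T + (Complex.I * (t : ℂ)) • (1 : Matrix n n ℂ)).det *
        (Complex.I * ((T + (Complex.I * (t : ℂ)) • (1 : Matrix n n ℂ))⁻¹).trace)) t := by
  have hJ := hasDerivAt_det_add_smul h 1
  have hs : HasDerivAt (fun s : ℝ ↦ Complex.I * (s : ℂ) - Complex.I * (t : ℂ)) Complex.I t := by
    simpa using ((Complex.ofRealCLM.hasDerivAt (x := t)).const_mul Complex.I).sub_const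
      (Complex.I * (t : ℂ))
  have hJ' : HasDerivAt (fun z : ℂ ↦
      (T + (Complex.I * (t : ℂ)) • (1 : Matrix n n ℂ) + z • (1 : Matrix n n ℂ)).det) _
      (Complex.I * (t : ℂ) - Complex.I * (t : ℂ)) := (sub_self (Complex.I * (t : ℂ))).symm ▸ hJ
  have := hJ'.comp t hs
  convert! this using 1
  · funext s
    simp [add_assoc, ← add_smul]
  · rw [mul_one]
    ring

theorem continuousAt_inv {A : Matrix n n ℂ} (hA : IsUnit A.det) :
    ContinuousAt (fun B : Matrix n n ℂ ↦ B⁻¹) A := by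
  simp only [inv_def, Ring.inverse_eq_inv']
  exact (continuous_id.matrix_det.continuousAt.inv₀ hA.ne_zero).smul
    continuous_id.matrix_adjugate.continuousAt

theorem resolvent_sub_resolvent_one {T : Matrix n n ℂ} {z : ℂ} (hz : 1 + z ≠ 0)
    (h : IsUnit (T + z • (1 : Matrix n n ℂ)).det) :
    (T + z • (1 : Matrix n n ℂ))⁻¹ - (1 + z)⁻¹ • (1 : Matrix n n ℂ) =
      ((1 + z)⁻¹ ^ 2) • ((1 + (1 + z)⁻¹ • (T - 1))⁻¹ * (1 - T)) := by
  have hM := add_smul_one_eq_smul T hz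
  have hN : IsUnit (1 + (1 + z)⁻¹ • (T - 1)).det := by
    rw [hM, det_smul] at h
    exact isUnit_of_mul_isUnit_right h
  have hT : 1 - T = (1 + z) • (1 - (1 + (1 + z)⁻¹ • (T - 1))) := by
    rw [sub_add_cancel_left, smul_neg, smul_smul, mul_inv_cancel₀ hz]
    simp
  have hinv : (T + z • (1 : Matrix n n ℂ))⁻¹ = (1 + z)⁻¹ • (1 + (1 + z)⁻¹ • (T - 1))⁻¹ := by
    rw [hM]
    exact inv_smul' _ (Units.mk0 _ hz) hN
  rw [hinv]
  conv_rhs => rw [hT, mul_smul_comm, smul_smul, mul_sub, mul_one, nonsing_inv_mul _ hN, pow_two,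
    mul_assoc, inv_mul_cancel₀ hz, mul_one, smul_sub]

theorem tendsto_det_div_det (T : Matrix n n ℂ) :
    Tendsto (fun t : ℝ ↦ (T + (Complex.I * (t : ℂ)) • (1 : Matrix n n ℂ)).det /
      ((1 : Matrix n n ℂ) + (Complex.I * (t : ℂ)) • (1 : Matrix n n ℂ)).det) atTop (𝓝 1) := by
  have h := (continuous_id.matrix_det.tendsto (1 : Matrix n n ℂ)).comp
    (tendsto_one_add_inv_smul (T - 1))
  simp only [id, det_one] at h
  refine h.congr fun t ↦ ?_
  have hz := Complex.one_add_I_mul_ofReal_ne_zero t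
  rw [add_smul_one_eq_smul T hz, one_add_smul_one, det_smul, det_smul, det_one, mul_one,
    mul_div_cancel_left₀ _ (pow_ne_zero _ hz)]
  rfl

theorem continuousAt_resolvent_sub {T : Matrix n n ℂ} {t : ℝ}
    (h : IsUnit (T + (Complex.I * (t : ℂ)) • (1 : Matrix n n ℂ)).det) :
    ContinuousAt (fun t : ℝ ↦ (T + (Complex.I * (t : ℂ)) • (1 : Matrix n n ℂ))⁻¹
      - (1 + Complex.I * (t : ℂ))⁻¹ • (1 : Matrix n n ℂ)) t := by
  have hM : ContinuousAt (fun t : ℝ ↦ T + (Complex.I * (t : ℂ)) • (1 : Matrix n n ℂ)) t := by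
    fun_prop
  have hz : ContinuousAt (fun t : ℝ ↦ 1 + Complex.I * (t : ℂ)) t := by fun_prop
  exact (ContinuousAt.comp (f := fun t : ℝ ↦ T + (Complex.I * (t : ℂ)) • (1 : Matrix n n ℂ))
    (continuousAt_inv h) hM).sub
      ((hz.inv₀ (Complex.one_add_I_mul_ofReal_ne_zero t)).smul continuousAt_const)

theorem integrableOn_resolvent_sub_apply {T : Matrix n n ℂ}
    (h : ∀ t : ℝ, 0 ≤ t → IsUnit (T + (Complex.I * (t : ℂ)) • (1 : Matrix n n ℂ)).det) (i j : n) :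
    IntegrableOn (fun t : ℝ ↦ ((T + (Complex.I * (t : ℂ)) • (1 : Matrix n n ℂ))⁻¹
      - (1 + Complex.I * (t : ℂ))⁻¹ • (1 : Matrix n n ℂ)) i j) (Ici 0) := by
  have hentry : Continuous fun A : Matrix n n ℂ ↦ A i j := continuous_id.matrix_elem i j
  have hcont : ContinuousOn (fun t : ℝ ↦ ((T + (Complex.I * (t : ℂ)) • (1 : Matrix n n ℂ))⁻¹
      - (1 + Complex.I * (t : ℂ))⁻¹ • (1 : Matrix n n ℂ)) i j) (Ici 0) := fun t ht ↦
    (hentry.continuousAt.comp (continuousAt_resolvent_sub (h t ht))).continuousWithinAt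
  have hlim : Tendsto (fun t : ℝ ↦ (1 + (1 + Complex.I * (t : ℂ))⁻¹ • (T - 1))⁻¹ * (1 - T)) atTop
      (𝓝 ((1 : Matrix n n ℂ)⁻¹ * (1 - T))) :=
    (((continuousAt_inv (A := (1 : Matrix n n ℂ)) (by simp)).tendsto).comp
      (tendsto_one_add_inv_smul (T - 1))).mul_const _
  have hsq : (fun t : ℝ ↦ (1 + Complex.I * (t : ℂ))⁻¹ ^ 2) =O[atTop]
      fun t : ℝ ↦ (1 + t ^ 2)⁻¹ := by
    refine Asymptotics.isBigO_of_le _ fun t ↦ le_of_eq ?_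
    have : ‖1 + Complex.I * (t : ℂ)‖ ^ 2 = 1 + t ^ 2 := by
      rw [← Complex.normSq_eq_norm_sq, Complex.normSq_apply]
      simp [sq]
    rw [norm_pow, norm_inv, inv_pow, this, Real.norm_of_nonneg (by positivity)]
  refine (hcont.locallyIntegrableOn measurableSet_Ici).integrableOn_of_isBigO_atTop (g :=
    fun t : ℝ ↦ (1 + t ^ 2)⁻¹) ?_ (integrable_inv_one_add_sq.integrableAtFilter _)
  have hO := hsq.mul (((hentry.tendsto _).comp hlim).isBigO_one ℝ)
  refine hO.congr' ?_ (.of_forall fun t ↦ by simp)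
  filter_upwards [eventually_ge_atTop 0] with t ht
  rw [resolvent_sub_resolvent_one (Complex.one_add_I_mul_ofReal_ne_zero t) (h t ht)]
  rfl

end Matrix

/-- The logarithmic derivative of `t ↦ det (T + it) / det (1 + it)` is `i` times the trace of the
integrand of `matLog T`; integrating it over `[0, ∞)` gives `exp (tr (log T)) = det T`. -/
theorem exp_trace_matLog {n : ℕ} {T : Matrix (Fin n) (Fin n) ℂ}
    (h : ∀ t : ℝ, 0 ≤ t →
      IsUnit (T + (Complex.I * (t : ℂ)) • (1 : Matrix (Fin n) (Fin n) ℂ)).det) :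
    Complex.exp (matLog T).trace = T.det := by
  set G : ℝ → Matrix (Fin n) (Fin n) ℂ := fun t ↦
    (T + (Complex.I * (t : ℂ)) • (1 : Matrix (Fin n) (Fin n) ℂ))⁻¹
      - (1 + Complex.I * (t : ℂ))⁻¹ • (1 : Matrix (Fin n) (Fin n) ℂ) with hG
  set q : ℝ → ℂ := fun t ↦ (T + (Complex.I * (t : ℂ)) • (1 : Matrix (Fin n) (Fin n) ℂ)).det /
      ((1 : Matrix (Fin n) (Fin n) ℂ) + (Complex.I * (t : ℂ)) • 1).det with hq
  have hGint (i j : Fin n) : IntegrableOn (fun t ↦ G t i j) (Ioi 0) :=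
    (integrableOn_resolvent_sub_apply h i j).mono_set Ioi_subset_Ici_self
  have hg : IntegrableOn (fun t ↦ (G t).trace) (Ioi 0) :=
    integrable_finsetSum _ fun i _ ↦ hGint i i
  have hentry (i j : Fin n) : (∫ t in Ioi (0 : ℝ), G t) i j = ∫ t in Ioi (0 : ℝ), G t i j :=
    (congrFun (eval_integral (f := fun t i j ↦ G t i j)
      (fun i ↦ Integrable.of_eval fun j ↦ hGint i j) i) j).trans
        (eval_integral (fun j ↦ hGint i j) j)
  have htr : (matLog T).trace = -(Complex.I * ∫ t in Ioi (0 : ℝ), (G t).trace) := by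
    rw [matLog, trace_smul, smul_eq_mul, neg_mul]
    simp only [trace, diag_apply]
    rw [integral_finsetSum _ fun i _ ↦ hGint i i]
    simp only [← hentry]
    rfl
  have h1 (t : ℝ) : IsUnit ((1 : Matrix (Fin n) (Fin n) ℂ) + (Complex.I * (t : ℂ)) • 1).det := by
    rw [one_add_smul_one, det_smul, det_one, mul_one]
    exact (pow_ne_zero _ (Complex.one_add_I_mul_ofReal_ne_zero t)).isUnit
  have h1inv (t : ℝ) : ((1 : Matrix (Fin n) (Fin n) ℂ) + (Complex.I * (t : ℂ)) • 1)⁻¹ =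
      (1 + Complex.I * (t : ℂ))⁻¹ • 1 := by
    refine inv_eq_right_inv ?_
    rw [one_add_smul_one, smul_mul_smul_comm,
      mul_inv_cancel₀ (Complex.one_add_I_mul_ofReal_ne_zero t), mul_one, one_smul]
  have hqderiv (t : ℝ) (ht : 0 ≤ t) : HasDerivAt q (q t * (Complex.I * (G t).trace)) t := by
    convert! (hasDerivAt_det_add_I_mul_smul_one (h t ht)).div
      (hasDerivAt_det_add_I_mul_smul_one (h1 t)) (h1 t).ne_zero using 1
    have := (h1 t).ne_zero
    simp only [hq, hG, h1inv, trace_sub]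
    field_simp
  have hgcont (t : ℝ)
      (ht : (T + (Complex.I * (t : ℂ)) • (1 : Matrix (Fin n) (Fin n) ℂ)).det ≠ 0) :
      ContinuousAt (fun t ↦ (G t).trace) t :=
    continuous_id.matrix_trace.continuousAt.comp (continuousAt_resolvent_sub ht.isUnit)
  have hFderiv (t : ℝ) (ht : 0 ≤ t) :
      HasDerivAt (fun u ↦ ∫ s in (0 : ℝ)..u, (G s).trace) (G t).trace t := by
    refine intervalIntegral.integral_hasDerivAt_right
      ((intervalIntegrable_iff_integrableOn_Ioc_of_le ht).mpr
        (hg.mono_set fun x hx ↦ hx.1)) ?_ (hgcont t (h t ht).ne_zero)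
    have hopen : IsOpen {s : ℝ | (T + (Complex.I * (s : ℂ)) • (1 : Matrix (Fin n) (Fin n) ℂ)).det
        ≠ 0} := isOpen_ne_fun (Continuous.matrix_det (by fun_prop)) continuous_const
    exact ContinuousAt.stronglyMeasurableAtFilter hopen hgcont t (h t ht).ne_zero
  have hE (t : ℝ) (ht : 0 ≤ t) : HasDerivAt
      (fun u ↦ q u * Complex.exp (-(Complex.I * ∫ s in (0 : ℝ)..u, (G s).trace))) 0 t := by
    convert! (hqderiv t ht).mul ((hFderiv t ht).const_mul Complex.I).neg.cexp using 1
    ring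
  have hconst (t : ℝ) (ht : 0 ≤ t) :
      q t * Complex.exp (-(Complex.I * ∫ s in (0 : ℝ)..t, (G s).trace)) = T.det := by
    have := constant_of_has_deriv_right_zero
      (fun x hx ↦ (hE x hx.1).continuousAt.continuousWithinAt)
      (fun x hx ↦ (hE x hx.1).hasDerivWithinAt) t ⟨ht, le_rfl⟩
    simpa [hq] using this
  have hlim : Tendsto
      (fun u ↦ q u * Complex.exp (-(Complex.I * ∫ s in (0 : ℝ)..u, (G s).trace))) atTop
      (𝓝 (1 * Complex.exp (-(Complex.I * ∫ s in Ioi (0 : ℝ), (G s).trace)))) :=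
    (tendsto_det_div_det T).mul (((intervalIntegral_tendsto_integral_Ioi 0
      hg tendsto_id).const_mul Complex.I).neg.cexp)
  rw [htr, ← one_mul (Complex.exp _)]
  refine tendsto_nhds_unique hlim (tendsto_const_nhds.congr' ?_)
  filter_upwards [eventually_ge_atTop 0] with t ht
  exact (hconst t ht).symm

/-- For an invertible matrix `T` with positive semidefinite imaginary part,
`exp (-2i · Im (tr (log T))) = det Tᴴ / det T`. -/
theorem exp_neg_two_I_im_trace_matLog (n : ℕ) (T : Matrix (Fin n) (Fin n) ℂ)
    (hTinv : IsUnit T)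
    (hT : ((2 * Complex.I)⁻¹ • (T - Tᴴ)).PosSemidef) :
    Complex.exp (-2 * Complex.I * ((matLog T).trace.im : ℂ)) = Tᴴ.det / T.det := by
  have hexp : Complex.exp (matLog T).trace = T.det :=
    exp_trace_matLog fun t ht ↦ isUnit_det_add_I_mul_smul_one hTinv hT ht
  have harg : -2 * Complex.I * ((matLog T).trace.im : ℂ) =
      (starRingEnd ℂ) (matLog T).trace - (matLog T).trace := by
    apply Complex.ext <;> simp
    ring
  rw [harg, Complex.exp_sub, Complex.exp_conj, hexp, det_conjTranspose]
  rfl
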